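/- Let (W, S) be a Coxeter system and β, γ two maximal partial special matchings on W. If β and γ agree on all principal dihedral elements below their arguments (i.e. β(v) = γ(v) for all v in P, the union of the principal dihedral subgroups), then β and γ have the same domain and agree everywhere on it. -/

import Mathlib

open CoxeterSystem Polynomial

section CoxPre

variable {B : Type*} {W : Type*} [Group W] {M : CoxeterMatrix B}

/-- The alternating word of length `n` starting with the letter `i`
(and then alternating between `i` and `j`). -/
def altW (i j : B) : ℕ → List B
  | 0 => []
  | n + 1 => i :: altW j i n

variable (cs : CoxeterSystem M W)

/-- The Bruhat order on a Coxeter group: the reflexive-transitive closure of the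
relation `u → u * t` (`t` a reflection) when the length goes up. -/
def bruhatLE : W → W → Prop :=
  Relation.ReflTransGen
    (fun u v => ∃ t, cs.IsReflection t ∧ v = u * t ∧ cs.length u < cs.length v)

/-- The covering relation of the Bruhat order. -/
def bCov (u v : W) : Prop :=
  bruhatLE cs u v ∧ u ≠ v ∧ ∀ z, bruhatLE cs u z → bruhatLE cs z v → z = u ∨ z = v

/-- The set of coatoms of `v` in the Bruhat order. -/
def bCoat (v : W) : Set W := {x | bCov cs x v}

/-- A partial special matching of `W` equipped with the Bruhat order: a Bruhat order
ideal `dom` together with an involution of it such that `u ⋖ φ u` or `φ u ⋖ u` for all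
`u ∈ dom`, satisfying the coatom condition. -/
structure BSM where
  dom : Set W
  toFun : W → W
  ideal : ∀ ⦃x y : W⦄, y ∈ dom → bruhatLE cs x y → x ∈ dom
  maps : ∀ x ∈ dom, toFun x ∈ dom
  invol : ∀ x ∈ dom, toFun (toFun x) = x
  cov : ∀ x ∈ dom, bCov cs (toFun x) x ∨ bCov cs x (toFun x)
  coatom : ∀ u ∈ dom, bCov cs u (toFun u) →
    bCoat cs (toFun u) =
      {u} ∪ {w | ∃ v, bCov cs v u ∧ bCov cs v (toFun v) ∧ w = toFun v}

/-- The standard dihedral subgroup `⟨s,t⟩` of `W`, as a set. -/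
def dihedral (s t : B) : Set W :=
  (Subgroup.closure {cs.simple s, cs.simple t} : Subgroup W)

/-- `w` is full with respect to `J ⊆ S`: for all distinct `i, j ∈ J`, `m i j < ∞` and the
longest element of `⟨i,j⟩` is `≤ w` in Bruhat order. -/
def IsFullWrt (J : Set B) (w : W) : Prop :=
  ∀ i ∈ J, ∀ j ∈ J, i ≠ j →
    M i j ≠ 0 ∧ bruhatLE cs (cs.wordProd (altW i j (M i j))) w

/-- The standard axioms characterizing the `R`-polynomials of the Hecke algebra of `W`. -/
def RAxioms (R : W → W → Polynomial ℤ) : Prop :=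
  (∀ u, R u u = 1) ∧
  (∀ u v, ¬ bruhatLE cs u v → R u v = 0) ∧
  (∀ (i : B) (x y : W),
      cs.length (cs.simple i * x) = cs.length x + 1 →
      cs.length (cs.simple i * y) = cs.length y + 1 →
      R (cs.simple i * x) (cs.simple i * y) = R x y ∧
      R x (cs.simple i * y) = (X - 1) * R x y + X * R (cs.simple i * x) y) ∧
  (∀ (i : B) (x y : W),
      cs.length (x * cs.simple i) = cs.length x + 1 →
      cs.length (y * cs.simple i) = cs.length y + 1 →
      R (x * cs.simple i) (y * cs.simple i) = R x y ∧
      R x (y * cs.simple i) = (X - 1) * R x y + X * R (x * cs.simple i) y)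

variable {cs}

/-- `ψ` extends the partial special matching `φ`. -/
def BExtends (ψ φ : BSM cs) : Prop :=
  φ.dom ⊆ ψ.dom ∧ ∀ x ∈ φ.dom, ψ.toFun x = φ.toFun x

/-- `φ` is a maximal partial special matching. -/
def BMax (φ : BSM cs) : Prop := ∀ ψ : BSM cs, BExtends ψ φ → ψ.dom = φ.dom

/-- `φ` is `g`-regular on the left: its domain is stable under left multiplication by `g`
and `φ` commutes with left multiplication by `g`. -/
def LeftReg (φ : BSM cs) (g : W) : Prop :=
  (∀ x ∈ φ.dom, g * x ∈ φ.dom) ∧ ∀ x ∈ φ.dom, φ.toFun (g * x) = g * φ.toFun x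

/-- `φ` is `g`-regular on the right. -/
def RightReg (φ : BSM cs) (g : W) : Prop :=
  (∀ x ∈ φ.dom, x * g ∈ φ.dom) ∧ ∀ x ∈ φ.dom, φ.toFun (x * g) = φ.toFun x * g

end CoxPre

namespace CoxeterSystem

variable {B : Type*} {W : Type*} [Group W] {M : CoxeterMatrix B} (cs : CoxeterSystem M W)

open scoped Classical in
/-- The action of a simple reflection on pairs of a group element and a sign. -/
noncomputable def signedConj (i : B) : Function.End (W × ZMod 2) :=
  fun p => (cs.simple i * p.1 * cs.simple i, p.2 + if p.1 = cs.simple i then 1 else 0)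

theorem pow_mul_simple_mul_pow (i j : B) (n : ℕ) :
    (cs.simple i * cs.simple j) ^ n * cs.simple j * (cs.simple i * cs.simple j) ^ n =
      cs.simple j := by
  induction n with
  | zero => simp
  | succ n ih =>
    nth_rewrite 1 [pow_succ]
    rw [pow_succ']
    calc _ = (cs.simple i * cs.simple j) ^ n * (cs.simple i * (cs.simple j * cs.simple j) *
          cs.simple i * cs.simple j) * (cs.simple i * cs.simple j) ^ n := by
          simp only [mul_assoc]
      _ = _ := by simpa using ih

open scoped Classical in
theorem signedConj_mul_pow (i j : B) (n : ℕ) (p : W × ZMod 2) :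
    ((cs.signedConj i * cs.signedConj j) ^ n) p =
      ((cs.simple i * cs.simple j) ^ n * p.1 * ((cs.simple i * cs.simple j) ^ n)⁻¹,
        p.2 + ∑ k ∈ Finset.range (2 * n),
          if p.1 = cs.simple j * (cs.simple i * cs.simple j) ^ k then 1 else 0) := by
  induction n with
  | zero => simp; rfl
  | succ n ih =>
    have h := cs.pow_mul_simple_mul_pow i j n
    rw [pow_succ']
    change cs.signedConj i (cs.signedConj j (((cs.signedConj i * cs.signedConj j) ^ n) p)) = _
    rw [ih]
    have h1 : ((cs.simple i * cs.simple j) ^ n * p.1 * ((cs.simple i * cs.simple j) ^ n)⁻¹ =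
        cs.simple j) ↔ p.1 = cs.simple j * (cs.simple i * cs.simple j) ^ (2 * n) := by
      rw [mul_inv_eq_iff_eq_mul]
      nth_rewrite 2 [← h]
      rw [mul_assoc _ _ (_ ^ n), mul_assoc _ (cs.simple j), mul_right_inj, two_mul, pow_add]
    have h2 : (cs.simple j * ((cs.simple i * cs.simple j) ^ n * p.1 *
        ((cs.simple i * cs.simple j) ^ n)⁻¹) * cs.simple j = cs.simple i) ↔
        p.1 = cs.simple j * (cs.simple i * cs.simple j) ^ (2 * n + 1) := by
      have e : cs.simple j * cs.simple i * cs.simple j * (cs.simple i * cs.simple j) ^ n =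
          (cs.simple i * cs.simple j) ^ n * (cs.simple j *
            (cs.simple i * cs.simple j) ^ (2 * n + 1)) := by
        rw [mul_assoc (cs.simple j), mul_assoc (cs.simple j), ← pow_succ']
        nth_rewrite 1 [← h]
        rw [show 2 * n + 1 = n + (n + 1) by ring, pow_add _ n (n + 1)]
        simp only [mul_assoc]
      rw [← mul_right_inj ((cs.simple i * cs.simple j) ^ n) (b := p.1), ← e,
        ← mul_inv_eq_iff_eq_mul]
      generalize (cs.simple i * cs.simple j) ^ n * p.1 * ((cs.simple i * cs.simple j) ^ n)⁻¹ = x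
      constructor
      · intro hh
        simp [← hh, mul_assoc]
      · intro hh
        simp [hh, mul_assoc]
    simp only [signedConj]
    rw [show 2 * (n + 1) = 2 * n + 1 + 1 by ring, Finset.sum_range_succ, Finset.sum_range_succ]
    simp only [h1, h2]
    refine Prod.ext ?_ ?_
    · simp [pow_succ', mul_assoc]
    · simp only [add_assoc]

theorem isLiftable_signedConj : M.IsLiftable cs.signedConj := by
  classical
  intro i j
  funext p
  rw [signedConj_mul_pow]
  change _ = p
  refine Prod.ext ?_ ?_
  · simp
  · simp only
    rw [two_mul, Finset.sum_range_add]
    simp only [pow_add, simple_mul_simple_pow, one_mul, CharTwo.add_self_eq_zero, add_zero]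

/-- The action of the group on pairs of a group element and a sign. -/
noncomputable def signedConjHom : W →* Function.End (W × ZMod 2) :=
  cs.lift ⟨cs.signedConj, cs.isLiftable_signedConj⟩

theorem signedConjHom_simple_apply (i : B) (p : W × ZMod 2) :
    cs.signedConjHom (cs.simple i) p = cs.signedConj i p := by
  rw [signedConjHom, lift_apply_simple]

theorem signedConjHom_mul_apply (u w : W) (p : W × ZMod 2) :
    cs.signedConjHom (u * w) p = cs.signedConjHom u (cs.signedConjHom w p) := by
  rw [map_mul]; rfl

/-- The reflection cocycle. -/
noncomputable def reflCocycle (w t : W) : ZMod 2 := (cs.signedConjHom w (t, 0)).2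

theorem signedConjHom_apply (w t : W) (e : ZMod 2) :
    cs.signedConjHom w (t, e) = (w * t * w⁻¹, e + cs.reflCocycle w t) := by
  induction w using cs.simple_induction_left generalizing e with
  | one =>
    have h (p) : cs.signedConjHom 1 p = p := by rw [map_one]; rfl
    simp [reflCocycle, h]
  | mul_simple_left w i ih =>
    rw [reflCocycle, signedConjHom_mul_apply, signedConjHom_mul_apply, ih, ih]
    simp [signedConjHom_simple_apply, signedConj, mul_assoc, add_assoc]

theorem reflCocycle_mul (u w t : W) :
    cs.reflCocycle (u * w) t = cs.reflCocycle w t + cs.reflCocycle u (w * t * w⁻¹) := by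
  rw [reflCocycle, signedConjHom_mul_apply, signedConjHom_apply, signedConjHom_apply]
  simp

open scoped Classical in
theorem reflCocycle_simple (i : B) (t : W) :
    cs.reflCocycle (cs.simple i) t = if t = cs.simple i then 1 else 0 := by
  rw [reflCocycle, signedConjHom_simple_apply]
  simp [signedConj]

theorem reflCocycle_one (t : W) : cs.reflCocycle 1 t = 0 := by
  simpa using cs.reflCocycle_mul 1 1 t

theorem reflCocycle_self {t : W} (ht : cs.IsReflection t) : cs.reflCocycle t t = 1 := by
  obtain ⟨u, i, rfl⟩ := ht
  have h := cs.reflCocycle_mul u u⁻¹ (u * cs.simple i * u⁻¹)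
  rw [mul_inv_cancel, reflCocycle_one] at h
  rw [mul_assoc u, reflCocycle_mul, reflCocycle_mul, ← mul_assoc u]
  simp only [mul_assoc, inv_inv, inv_mul_cancel_left, inv_mul_cancel, mul_one, mul_inv_rev,
    inv_simple, simple_mul_simple_self] at h ⊢
  simp only [reflCocycle_simple, if_true]
  rw [add_right_comm, ← h, zero_add]

theorem length_mul_lt_of_reflCocycle_ne_zero {w t : W} (h : cs.reflCocycle w t ≠ 0) :
    cs.length (w * t) < cs.length w := by
  classical
  induction hn : cs.length w using Nat.strong_induction_on generalizing w with
  | _ n ih =>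
    have hw : w ≠ 1 := by
      rintro rfl
      exact h (cs.reflCocycle_one t)
    obtain ⟨i, hi⟩ := cs.exists_leftDescent_of_ne_one hw
    unfold IsLeftDescent at hi
    have hw' : w = cs.simple i * (cs.simple i * w) := by simp
    have e := cs.reflCocycle_mul (cs.simple i) (cs.simple i * w) t
    rw [← hw', reflCocycle_simple] at e
    by_cases h0 : cs.reflCocycle (cs.simple i * w) t = 0
    · have h1 : cs.simple i * w * t * (cs.simple i * w)⁻¹ = cs.simple i := by
        by_contra hne
        rw [h0, if_neg hne, add_zero] at e
        exact h e
      rw [mul_inv_eq_iff_eq_mul, ← hw', mul_assoc] at h1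
      have : w * t = cs.simple i * w := by
        nth_rewrite 2 [← h1]
        simp
      rw [this]; lia
    · have h1 := ih _ (by lia) h0 rfl
      have h2 : w * t = cs.simple i * (cs.simple i * w * t) := by simp [mul_assoc]
      have h3 := cs.length_mul_le (cs.simple i) (cs.simple i * w * t)
      rw [← h2, length_simple] at h3
      lia

theorem reflCocycle_eq_one_iff {w t : W} (ht : cs.IsReflection t) :
    cs.reflCocycle w t = 1 ↔ cs.length (w * t) < cs.length w := by
  constructor
  · intro h
    exact cs.length_mul_lt_of_reflCocycle_ne_zero (by simp [h])
  · intro h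
    by_contra hne
    have h0 : cs.reflCocycle w t = 0 := by
      revert hne
      generalize cs.reflCocycle w t = x
      revert x
      decide
    have h1 : cs.reflCocycle (w * t) t = 1 := by
      rw [reflCocycle_mul, reflCocycle_self cs ht]
      simp [h0]
    have h2 := cs.length_mul_lt_of_reflCocycle_ne_zero (w := w * t) (t := t) (by simp [h1])
    rw [mul_assoc, ht.mul_self, mul_one] at h2
    lia

theorem mul_eq_simple_mul_of_length_lt {v t : W} (ht : cs.IsReflection t) (i : B)
    (h1 : cs.length (v * t) < cs.length v)
    (h2 : cs.length (cs.simple i * v) < cs.length (cs.simple i * (v * t))) :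
    v * t = cs.simple i * v := by
  classical
  rw [← mul_assoc] at h2
  have e1 := (cs.reflCocycle_eq_one_iff ht).2 h1
  have e2 : cs.reflCocycle (cs.simple i * v) t ≠ 1 := by
    rw [Ne, cs.reflCocycle_eq_one_iff ht]
    lia
  rw [reflCocycle_mul, e1, reflCocycle_simple] at e2
  have h : v * t * v⁻¹ = cs.simple i := by
    by_contra hne
    simp [hne] at e2
  rwa [mul_inv_eq_iff_eq_mul] at h

end CoxeterSystem

section Bruhat

variable {B : Type*} {W : Type*} [Group W] {M : CoxeterMatrix B} {cs : CoxeterSystem M W}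

theorem bruhatLE.length_lt {u v : W} (h : bruhatLE cs u v) :
    u = v ∨ cs.length u < cs.length v := by
  induction h with
  | refl => exact Or.inl rfl
  | tail _ h ih =>
    obtain ⟨t, -, -, h⟩ := h
    rcases ih with rfl | ih
    · exact Or.inr h
    · exact Or.inr (ih.trans h)

theorem bruhatLE.mul_reflection {u t : W} (ht : cs.IsReflection t)
    (h : cs.length u < cs.length (u * t)) : bruhatLE cs u (u * t) :=
  Relation.ReflTransGen.single ⟨t, ht, rfl, h⟩

theorem bruhatLE_simple_mul {v : W} {i : B}
    (h : cs.length v < cs.length (cs.simple i * v)) : bruhatLE cs v (cs.simple i * v) := by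
  have e : cs.simple i * v = v * (v⁻¹ * cs.simple i * v⁻¹⁻¹) := by simp [mul_assoc]
  rw [e] at h ⊢
  exact bruhatLE.mul_reflection ((cs.isReflection_simple i).conj _) h

theorem simple_mul_bruhatLE {v : W} {i : B}
    (h : cs.length (cs.simple i * v) < cs.length v) : bruhatLE cs (cs.simple i * v) v := by
  simpa using bruhatLE_simple_mul (cs := cs) (v := cs.simple i * v) (i := i) (by simpa using h)

theorem mul_simple_bruhatLE {v : W} {i : B}
    (h : cs.length (v * cs.simple i) < cs.length v) : bruhatLE cs (v * cs.simple i) v := by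
  simpa using bruhatLE.mul_reflection (cs := cs) (u := v * cs.simple i)
    (cs.isReflection_simple i) (by simpa using h)

/-- The lifting property of the Bruhat order. -/
theorem bruhatLE.le_simple_mul {u v : W} {i : B} (h : bruhatLE cs u v)
    (hu : cs.length u < cs.length (cs.simple i * u)) : bruhatLE cs u (cs.simple i * v) := by
  suffices H : bruhatLE cs u (cs.simple i * v) ∨
      bruhatLE cs (cs.simple i * u) (cs.simple i * v) from
    H.elim id fun H => (bruhatLE_simple_mul hu).trans H
  clear hu
  induction h using Relation.ReflTransGen.head_induction_on with
  | refl => exact Or.inr Relation.ReflTransGen.refl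
  | @head u u₁ hs _ ih =>
    rcases ih with ih | ih
    · exact Or.inl (Relation.ReflTransGen.head hs ih)
    · obtain ⟨t, ht, rfl, hl⟩ := hs
      rcases lt_or_ge (cs.length (cs.simple i * u)) (cs.length (cs.simple i * (u * t)))
        with h1 | h1
      · exact Or.inr (Relation.ReflTransGen.head ⟨t, ht, by rw [mul_assoc], h1⟩ ih)
      · have e : u * t * t = u := by rw [mul_assoc, ht.mul_self, mul_one]
        have hne : cs.length (cs.simple i * (u * t)) ≠ cs.length (cs.simple i * u) := by
          rw [← mul_assoc]
          exact ht.length_mul_left_ne _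
        have := cs.mul_eq_simple_mul_of_length_lt (v := u * t) ht i (by rwa [e])
          (by rw [e]; lia)
        rw [e] at this
        rw [← this] at ih
        exact Or.inl ih

theorem bCov.length_lt {u v : W} (h : bCov cs u v) : cs.length u < cs.length v :=
  h.1.length_lt.resolve_left h.2.1

theorem bCov_of_length_eq {u v : W} (h : bruhatLE cs u v)
    (hl : cs.length v = cs.length u + 1) : bCov cs u v := by
  refine ⟨h, by rintro rfl; lia, fun z h1 h2 => ?_⟩
  rcases h1.length_lt with h1 | h1
  · exact Or.inl h1.symm
  · rcases h2.length_lt with h2 | h2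
    · exact Or.inr h2
    · lia

theorem simple_mul_bCov {v : W} {i : B}
    (h : cs.length (cs.simple i * v) < cs.length v) : bCov cs (cs.simple i * v) v :=
  bCov_of_length_eq (simple_mul_bruhatLE h) (by have := cs.length_simple_mul v i; lia)

theorem mul_simple_bCov {v : W} {i : B}
    (h : cs.length (v * cs.simple i) < cs.length v) : bCov cs (v * cs.simple i) v :=
  bCov_of_length_eq (mul_simple_bruhatLE h) (by have := cs.length_mul_simple v i; lia)

theorem bCov.eq_simple_mul {c v : W} {i : B} (h : bCov cs c v)
    (hc : ¬ cs.length (cs.simple i * c) < cs.length c)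
    (hv : cs.length (cs.simple i * v) < cs.length v) : c = cs.simple i * v := by
  have hc' := cs.length_simple_mul c i
  rcases h.2.2 _ (h.1.le_simple_mul (i := i) (by lia)) (simple_mul_bruhatLE hv) with h | h
  · exact h.symm
  · rw [h] at hv; lia

theorem length_simple_mul_lt_of_mul_simple {y : W} {i j : B}
    (h : cs.length (y * cs.simple j) < cs.length y)
    (hi : cs.length (cs.simple i * (y * cs.simple j)) < cs.length (y * cs.simple j)) :
    cs.length (cs.simple i * y) < cs.length y := by
  have h1 := cs.length_mul_simple (cs.simple i * y) j
  rw [mul_assoc] at h1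
  lia

theorem mem_closure_of_unique_leftDescent {s t q r : B} {y z : W}
    (hl : cs.length y = cs.length z)
    (hy : ∀ i, cs.length (cs.simple i * y) < cs.length y → cs.simple i = cs.simple s)
    (hz : ∀ i, cs.length (cs.simple i * z) < cs.length z → cs.simple i = cs.simple t)
    (hsy : cs.simple s * y = z * cs.simple q) (htz : cs.simple t * z = y * cs.simple r) :
    y ∈ Subgroup.closure {cs.simple s, cs.simple t} ∧
      ∀ a, bruhatLE cs (cs.simple a) y → cs.simple a = cs.simple s ∨ cs.simple a = cs.simple t := by
  induction hn : cs.length y generalizing s t q r y z with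
  | zero =>
    rw [cs.length_eq_zero_iff] at hn
    subst hn
    refine ⟨one_mem _, fun a ha => ?_⟩
    have := cs.length_simple a
    rcases ha.length_lt with h | h
    · rw [h] at this; simp at this
    · simp at h
  | succ n ih =>
    have hdesc {w : W} {s : B} (hw : cs.length w = n + 1)
        (h : ∀ i, cs.length (cs.simple i * w) < cs.length w → cs.simple i = cs.simple s) :
        cs.length (cs.simple s * w) < cs.length w := by
      obtain ⟨i, hi⟩ := cs.exists_leftDescent_of_ne_one (w := w) (by rintro rfl; simp at hw)
      rw [← h i hi]
      exact hi
    have hy1 := hdesc hn hy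
    have hz1 := hdesc (hl ▸ hn) hz
    have hy2 := cs.length_simple_mul y s
    have hz2 := cs.length_simple_mul z t
    obtain ⟨h1, h2⟩ := ih (s := t) (t := s) (q := q) (r := r) (y := cs.simple s * y)
      (z := cs.simple t * z) (by lia)
      (fun i hi => hz i (by
        rw [hsy] at hi
        exact length_simple_mul_lt_of_mul_simple (by rw [← hsy]; lia) hi))
      (fun i hi => hy i (by
        rw [htz] at hi
        exact length_simple_mul_lt_of_mul_simple (by rw [← htz]; lia) hi))
      (by rw [hsy, ← mul_assoc]) (by rw [htz, ← mul_assoc]) (by lia)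
    rw [Set.pair_comm] at h1
    refine ⟨?_, fun a ha => ?_⟩
    · have h3 := mul_mem (Subgroup.subset_closure (Set.mem_insert _ _)) h1
      rwa [cs.simple_mul_simple_cancel_left] at h3
    · by_cases hsa : cs.length (cs.simple s * cs.simple a) < cs.length (cs.simple a)
      · rw [cs.length_simple, Nat.lt_one_iff, cs.length_eq_zero_iff, mul_eq_one_iff_eq_inv,
          cs.inv_simple] at hsa
        exact Or.inl hsa.symm
      · have := cs.length_simple_mul (cs.simple a) s
        exact (h2 a (ha.le_simple_mul (by lia))).symm

/-- Distinct elements with the same coatoms lie in a common dihedral parabolic subgroup. -/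
theorem exists_mem_closure_of_bCoat_eq {y z : W} (hne : y ≠ z) (hy1 : y ≠ 1) (hz1 : z ≠ 1)
    (h : bCoat cs y = bCoat cs z) :
    ∃ s t : B, cs.simple s ≠ cs.simple t ∧ y ∈ Subgroup.closure {cs.simple s, cs.simple t} ∧
      ∀ a, bruhatLE cs (cs.simple a) y →
        cs.simple a = cs.simple s ∨ cs.simple a = cs.simple t := by
  have hc (c : W) : bCov cs c y ↔ bCov cs c z := Set.ext_iff.1 h c
  have hdisj (i : B) (hy : cs.length (cs.simple i * y) < cs.length y)
      (hz : cs.length (cs.simple i * z) < cs.length z) : False := by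
    have := ((hc _).1 (simple_mul_bCov hy)).eq_simple_mul (by simpa using hy.le) hz
    exact hne (mul_left_cancel this)
  have hyz {r t : B} (hr : cs.length (y * cs.simple r) < cs.length y)
      (ht : cs.length (cs.simple t * z) < cs.length z) : cs.simple t * z = y * cs.simple r :=
    (((hc _).1 (mul_simple_bCov hr)).eq_simple_mul
      (fun h => hdisj t (length_simple_mul_lt_of_mul_simple hr h) ht) ht).symm
  have hzy {q s : B} (hq : cs.length (z * cs.simple q) < cs.length z)
      (hs : cs.length (cs.simple s * y) < cs.length y) : cs.simple s * y = z * cs.simple q :=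
    (((hc _).2 (mul_simple_bCov hq)).eq_simple_mul
      (fun h => hdisj s hs (length_simple_mul_lt_of_mul_simple hq h)) hs).symm
  obtain ⟨s, hs⟩ := cs.exists_leftDescent_of_ne_one hy1
  obtain ⟨t, ht⟩ := cs.exists_leftDescent_of_ne_one hz1
  obtain ⟨r, hr⟩ := cs.exists_rightDescent_of_ne_one hy1
  obtain ⟨q, hq⟩ := cs.exists_rightDescent_of_ne_one hz1
  refine ⟨s, t, fun e => ?_, mem_closure_of_unique_leftDescent (q := q) (r := r) ?_
    (fun i hi => mul_right_cancel ((hzy hq hi).trans (hzy hq hs).symm))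
    (fun i hi => mul_right_cancel ((hyz hr hi).trans (hyz hr ht).symm)) (hzy hq hs) (hyz hr ht)⟩
  · unfold CoxeterSystem.IsLeftDescent at hs ht
    rw [e] at hs
    exact hdisj t hs ht
  · have h1 := cs.isLeftDescent_iff.1 ht
    have h2 := cs.isRightDescent_iff.1 hr
    rw [hyz hr ht] at h1
    lia

namespace BSM

theorem simple_le_apply (φ : BSM cs) {a : B} (ha : φ.toFun 1 = cs.simple a) {u : W}
    (hu : u ∈ φ.dom) (h : bCov cs u (φ.toFun u)) : bruhatLE cs (cs.simple a) (φ.toFun u) := by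
  induction hn : cs.length u using Nat.strong_induction_on generalizing u with
  | _ n ih =>
    by_cases h1 : u = 1
    · rw [h1, ha]
      exact Relation.ReflTransGen.refl
    · obtain ⟨r, hr⟩ := cs.exists_rightDescent_of_ne_one h1
      have hv : bCov cs (u * cs.simple r) u := mul_simple_bCov hr
      have hvd := φ.ideal hu hv.1
      rcases φ.cov _ hvd with hd | hup
      · have hwd := φ.maps _ hvd
        have e := φ.invol _ hvd
        have := ih _ (by have := hd.length_lt; have := hv.length_lt; lia) hwd
          (by rwa [e]) rfl
        rw [e] at this
        exact (this.trans hv.1).trans h.1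
      · have hco : φ.toFun (u * cs.simple r) ∈ bCoat cs (φ.toFun u) := by
          rw [φ.coatom u hu h]
          exact Or.inr ⟨_, hv, hup, rfl⟩
        exact (ih _ (by have := hv.length_lt; lia) hvd hup rfl).trans hco.1

/-- Two partial special matchings agreeing on all principal dihedral elements agree wherever
both are defined. -/
theorem apply_eq_apply (β γ : BSM cs) {a : B} (haβ : β.toFun 1 = cs.simple a)
    (haγ : γ.toFun 1 = cs.simple a)
    (hagree : ∀ v : W, (∃ s : B, s ≠ a ∧ v ∈ dihedral cs s a) →
      v ∈ β.dom ∧ v ∈ γ.dom ∧ β.toFun v = γ.toFun v) {x : W} (hxβ : x ∈ β.dom)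
    (hxγ : x ∈ γ.dom) : β.toFun x = γ.toFun x := by
  induction hn : cs.length x using Nat.strong_induction_on generalizing x with
  | _ n ih =>
    rcases β.cov x hxβ with hb | hb
    · have e := ih _ (hn ▸ hb.length_lt) (β.maps _ hxβ) (γ.ideal hxγ hb.1) rfl
      rw [β.invol _ hxβ] at e
      have e' := γ.invol _ (γ.ideal hxγ hb.1)
      rwa [← e, eq_comm] at e'
    rcases γ.cov x hxγ with hc | hc
    · have e := ih _ (hn ▸ hc.length_lt) (β.ideal hxβ hc.1) (γ.maps _ hxγ) rfl
      rw [γ.invol _ hxγ] at e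
      have e' := β.invol _ (β.ideal hxβ hc.1)
      rwa [e] at e'
    by_contra hne
    have hcoat : bCoat cs (β.toFun x) = bCoat cs (γ.toFun x) := by
      rw [β.coatom x hxβ hb, γ.coatom x hxγ hc]
      congr 1
      ext w
      refine exists_congr fun v => and_congr_right fun hv => ?_
      rw [ih _ (hn ▸ hv.length_lt) (β.ideal hxβ hv.1) (γ.ideal hxγ hv.1) rfl]
    have hne1 {w : W} (hw : bCov cs x w) : w ≠ 1 := by
      rintro rfl
      simpa using hw.length_lt
    obtain ⟨s, t, hst, hmem, hsupp⟩ :=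
      exists_mem_closure_of_bCoat_eq hne (hne1 hb) (hne1 hc) hcoat
    have hdih : ∃ s : B, s ≠ a ∧ β.toFun x ∈ dihedral cs s a := by
      rcases hsupp a (β.simple_le_apply haβ hxβ hb) with h | h
      · refine ⟨t, ?_, ?_⟩
        · rintro rfl
          exact hst h.symm
        · rw [dihedral, h, Set.pair_comm]
          exact hmem
      · refine ⟨s, ?_, ?_⟩
        · rintro rfl
          exact hst h
        · rw [dihedral, h]
          exact hmem
    obtain ⟨-, h2, h3⟩ := hagree _ hdih
    rw [β.invol _ hxβ] at h3
    have e := γ.invol _ h2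
    rw [← h3] at e
    exact hne e.symm

open scoped Classical in
/-- The common extension of two partial special matchings that agree wherever both are
defined. -/
noncomputable def union (β γ : BSM cs)
    (h : ∀ x ∈ β.dom, x ∈ γ.dom → β.toFun x = γ.toFun x) : BSM cs :=
  let f : W → W := fun x => if x ∈ β.dom then β.toFun x else γ.toFun x
  have hβ : ∀ x ∈ β.dom, f x = β.toFun x := fun _ hx => if_pos hx
  have hγ : ∀ x ∈ γ.dom, f x = γ.toFun x := fun x hx => by
    by_cases hx' : x ∈ β.dom
    · rw [hβ x hx', h x hx' hx]
    · exact if_neg hx'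
  have hco : ∀ φ : BSM cs, (∀ x ∈ φ.dom, f x = φ.toFun x) → ∀ u ∈ φ.dom, bCov cs u (f u) →
      bCoat cs (f u) = {u} ∪ {w | ∃ v, bCov cs v u ∧ bCov cs v (f v) ∧ w = f v} := by
    intro φ hφ u hu hc
    rw [hφ u hu] at hc ⊢
    rw [φ.coatom u hu hc]
    congr 1
    ext w
    refine exists_congr fun v => and_congr_right fun hv => ?_
    rw [hφ v (φ.ideal hu hv.1)]
  { dom := β.dom ∪ γ.dom
    toFun := f
    ideal := fun _ _ hy hxy => hy.imp (fun hy => β.ideal hy hxy) fun hy => γ.ideal hy hxy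
    maps := by
      rintro x (hx | hx)
      · rw [hβ x hx]
        exact Or.inl (β.maps x hx)
      · rw [hγ x hx]
        exact Or.inr (γ.maps x hx)
    invol := by
      rintro x (hx | hx)
      · rw [hβ x hx, hβ _ (β.maps x hx), β.invol x hx]
      · rw [hγ x hx, hγ _ (γ.maps x hx), γ.invol x hx]
    cov := by
      rintro x (hx | hx)
      · rw [hβ x hx]
        exact β.cov x hx
      · rw [hγ x hx]
        exact γ.cov x hx
    coatom := by
      rintro u (hu | hu)
      · exact hco β hβ u hu
      · exact hco γ hγ u hu }

theorem union_extends_left (β γ : BSM cs)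
    (h : ∀ x ∈ β.dom, x ∈ γ.dom → β.toFun x = γ.toFun x) : BExtends (β.union γ h) β :=
  ⟨Set.subset_union_left, fun _ hx => if_pos hx⟩

theorem union_extends_right (β γ : BSM cs)
    (h : ∀ x ∈ β.dom, x ∈ γ.dom → β.toFun x = γ.toFun x) : BExtends (β.union γ h) γ := by
  refine ⟨Set.subset_union_right, fun x hx => ?_⟩
  by_cases hx' : x ∈ β.dom
  · exact (if_pos hx').trans (h x hx' hx)
  · exact if_neg hx'

end BSM

end Bruhat

/-- two maximal partial special matchings with `β(e) = γ(e) = a` that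
agree on all principal dihedral elements have the same domain and agree everywhere. -/
theorem stmt6 {B : Type*} {W : Type*} [Group W] {M : CoxeterMatrix B}
    (cs : CoxeterSystem M W) (β γ : BSM cs) (hβ : BMax β) (hγ : BMax γ)
    (h1β : (1 : W) ∈ β.dom) (h1γ : (1 : W) ∈ γ.dom)
    (a : B) (haβ : β.toFun 1 = cs.simple a) (haγ : γ.toFun 1 = cs.simple a)
    (hagree : ∀ v : W, (∃ s : B, s ≠ a ∧ v ∈ dihedral cs s a) →
      v ∈ β.dom ∧ v ∈ γ.dom ∧ β.toFun v = γ.toFun v) :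
    β.dom = γ.dom ∧ ∀ x ∈ β.dom, β.toFun x = γ.toFun x := by
  have h : ∀ x ∈ β.dom, x ∈ γ.dom → β.toFun x = γ.toFun x := fun _ hxβ hxγ =>
    β.apply_eq_apply γ haβ haγ hagree hxβ hxγ
  have hdom : β.dom = γ.dom :=
    (hβ _ (β.union_extends_left γ h)).symm.trans (hγ _ (β.union_extends_right γ h))
  exact ⟨hdom, fun x hx => h x hx (hdom ▸ hx)⟩
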